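/- arXiv:2512.20163 — 8 statements merged into one kernel-verified Lean document; each statement's English description precedes it below -/
import Mathlib

section
/- Let x and L be natural numbers with x < 2^(L+1). Define y as the result of the following greedy process: start with y = 0 and, for ℓ = L, L−1, …, 1 in decreasing order, replace y by y + 2^ℓ whenever y + 2^ℓ ≤ x. Then the final value satisfies y = 2·⌊x/2⌋ = x − (x mod 2); in particular the final y equals x if and only if x is even. -/
/-- The greedy balance-scale process of the Parity protocol:
starting from `0`, for `ℓ = L, L-1, …, 1` add the weight `2^ℓ`
whenever doing so does not exceed `x`. -/
def greedyParity (x L : ℕ) : ℕ :=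
  ((List.range L).reverse.map (· + 1)).foldl
    (fun y ℓ => if y + 2 ^ ℓ ≤ x then y + 2 ^ ℓ else y) 0

theorem greedy_aux (x L : ℕ) : ∀ y : ℕ, y % 2 = 0 → y ≤ x → x < y + 2 ^ (L + 1) →
    ((List.range L).reverse.map (· + 1)).foldl
      (fun y ℓ => if y + 2 ^ ℓ ≤ x then y + 2 ^ ℓ else y) y = 2 * (x / 2) := by
  induction L with
  | zero =>
    intro y h0 h1 h2
    simp at h2 ⊢
    omega
  | succ L ih =>
    intro y h0 h1 h2
    rw [List.range_succ, List.reverse_append]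
    simp only [List.reverse_singleton, List.singleton_append, List.map_cons, List.foldl_cons]
    have e1 : 2 ^ (L + 1 + 1) = 2 * 2 ^ (L + 1) := by ring
    have e2 : 2 ^ (L + 1) = 2 * 2 ^ L := by ring
    apply ih
    · split_ifs <;> omega
    · split_ifs <;> omega
    · split_ifs <;> omega

theorem stmt1 (x L : ℕ) (hx : x < 2 ^ (L + 1)) :
    greedyParity x L = 2 * (x / 2) ∧ greedyParity x L = x - x % 2 ∧
      (greedyParity x L = x ↔ Even x) := by
  have h : greedyParity x L = 2 * (x / 2) :=
    greedy_aux x L 0 rfl (Nat.zero_le _) (by simpa using hx)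
  refine ⟨h, ?_, ?_⟩
  · omega
  · rw [h, Nat.even_iff]
    omega
end

section
/- Let m ≥ 2 and let m_0, m_1, …, m_k be a doubling–increment chain for m. Then for every integer μ with 0 < μ < m there exist s ≥ 1 and strictly decreasing indices i_1 > i_2 > … > i_s, all in {0, 1, …, k−1}, such that μ = m_{i_1} + m_{i_2} + … + m_{i_s} and, for every j with 1 ≤ j ≤ s−1 (i.e., for every chosen index except the smallest one), m_{i_j + 1} = 2·m_{i_j}. -/
/-- A doubling–increment chain for `m`: a sequence `f 0, …, f k` of positive
integers with `f 0 = 1`, `f k = m`, and each step either doubles or adds one. -/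
def DIChain (m k : ℕ) (f : ℕ → ℕ) : Prop :=
  f 0 = 1 ∧ f k = m ∧ (∀ i ≤ k, 0 < f i) ∧
    ∀ i < k, f (i + 1) = 2 * f i ∨ f (i + 1) = f i + 1

theorem stmt3_aux (f : ℕ → ℕ) (h0 : f 0 = 1) (k : ℕ)
    (hs : ∀ i < k, f (i + 1) = 2 * f i ∨ f (i + 1) = f i + 1) :
    ∀ μ : ℕ, 0 < μ → μ < f k →
    ∃ s : ℕ, 1 ≤ s ∧ ∃ idx : Fin s → ℕ, StrictAnti idx ∧
      (∀ j, idx j < k) ∧ μ = ∑ j, f (idx j) ∧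
      ∀ j : Fin s, (j : ℕ) + 1 < s → f (idx j + 1) = 2 * f (idx j) := by
  induction k with
  | zero => intro μ h1 h2; omega
  | succ k ih =>
    intro μ h1 h2
    have ih := ih (fun i hi => hs i (by omega))
    rcases lt_trichotomy μ (f k) with h | h | h
    · obtain ⟨s, hs1, idx, ha, hb, hc, hd⟩ := ih μ h1 h
      exact ⟨s, hs1, idx, ha, fun j => (hb j).trans (Nat.lt_succ_self k), hc, hd⟩
    · refine ⟨1, le_refl 1, fun _ => k, Subsingleton.strictAnti _, fun _ => Nat.lt_succ_self k,
        by simpa using h, ?_⟩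
      intro j hj
      omega
    · have hk : f (k + 1) = 2 * f k := by
        rcases hs k (Nat.lt_succ_self k) with h' | h' <;> omega
      obtain ⟨s, hs1, idx, ha, hb, hc, hd⟩ := ih (μ - f k) (by omega) (by omega)
      refine ⟨s + 1, by omega, Fin.cons k idx, ?_, ?_, ?_, ?_⟩
      · intro a b hab
        induction b using Fin.cases with
        | zero => exact absurd hab (Fin.not_lt_zero a)
        | succ b =>
          induction a using Fin.cases with
          | zero => simpa using hb b
          | succ a => simpa using ha (Fin.succ_lt_succ_iff.mp hab)
      · intro j
        induction j using Fin.cases with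
        | zero => simp
        | succ j => simpa using (hb j).trans (Nat.lt_succ_self k)
      · rw [Fin.sum_univ_succ]
        simp only [Fin.cons_zero, Fin.cons_succ]
        omega
      · intro j hj
        induction j using Fin.cases with
        | zero => simpa using hk
        | succ j =>
          simp only [Fin.cons_succ]
          exact hd j (by simpa using hj)

theorem stmt3 (m k : ℕ) (f : ℕ → ℕ) (hm : 2 ≤ m) (hchain : DIChain m k f)
    (μ : ℕ) (hμ0 : 0 < μ) (hμm : μ < m) :
    ∃ s : ℕ, 1 ≤ s ∧ ∃ idx : Fin s → ℕ, StrictAnti idx ∧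
      (∀ j, idx j < k) ∧ μ = ∑ j, f (idx j) ∧
      ∀ j : Fin s, (j : ℕ) + 1 < s → f (idx j + 1) = 2 * f (idx j) := by
  obtain ⟨h0, hk, _, hs⟩ := hchain
  exact stmt3_aux f h0 k hs μ hμ0 (by omega)
end

section
/- Let m ≥ 2, let m_0, m_1, …, m_k be a doubling–increment chain for m, let n ≥ 0 be a real number, and let T : ℕ → ℝ satisfy T(0) = 0 and, for every j < k: if m_{j+1} = m_j + 1 then T(j+1) ≤ T(j) + (3/2)·n, and if m_{j+1} = 2·m_j then T(j+1) ≤ 2·T(j) + (3/2)·n. Then T(j) ≤ (3/2)·(m_j − 1)·n for every j ≤ k. -/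
theorem stmt4 (m k : ℕ) (f : ℕ → ℕ) (hm : 2 ≤ m) (hchain : DIChain m k f)
    (n : ℝ) (hn : 0 ≤ n) (T : ℕ → ℝ) (hT0 : T 0 = 0)
    (hstep : ∀ j < k,
      (f (j + 1) = f j + 1 → T (j + 1) ≤ T j + 3 / 2 * n) ∧
      (f (j + 1) = 2 * f j → T (j + 1) ≤ 2 * T j + 3 / 2 * n)) :
    ∀ j ≤ k, T j ≤ 3 / 2 * ((f j : ℝ) - 1) * n := by
  obtain ⟨h0, _, _, hs⟩ := hchain
  intro j
  induction j with
  | zero => intro _; simp [h0, hT0]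
  | succ j ih =>
    intro hj
    have ih' := ih (by omega)
    obtain ⟨ha, hb⟩ := hstep j (by omega)
    rcases hs j (by omega) with h | h
    · have h1 := hb h
      rw [h]
      push_cast
      linarith
    · have h1 := ha h
      rw [h]
      push_cast
      linarith
end

section
/- For every natural number ℓ ≥ 2, the number of subsets of tails among ℓ fair coin flips in which at least half but not all of the flips are tails is at least (3/8)·2^ℓ; equivalently, 8 · Σ_{t : ℓ ≤ 2t and t < ℓ} C(ℓ, t) ≥ 3 · 2^ℓ, where C(ℓ, t) denotes the binomial coefficient and the sum ranges over integers t with ℓ ≤ 2t and t < ℓ. -/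
theorem stmt5 (ℓ : ℕ) (hℓ : 2 ≤ ℓ) :
    3 * 2 ^ ℓ ≤
      8 * ∑ t ∈ (Finset.range ℓ).filter (fun t => ℓ ≤ 2 * t), ℓ.choose t := by
  rcases Nat.lt_or_ge ℓ 3 with h | h
  · obtain rfl : ℓ = 2 := by omega
    decide
  rw [Finset.sum_filter]
  have h1 := Finset.sum_range_succ (fun t => if ℓ ≤ 2 * t then ℓ.choose t else 0) ℓ
  have h2 := Finset.sum_range_reflect (fun t => if ℓ ≤ 2 * t then ℓ.choose t else 0) (ℓ + 1)
  have h3 : 2 ^ ℓ ≤ ∑ t ∈ Finset.range (ℓ + 1), (if ℓ ≤ 2 * t then ℓ.choose t else 0)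
      + ∑ t ∈ Finset.range (ℓ + 1),
        (if ℓ ≤ 2 * (ℓ + 1 - 1 - t) then ℓ.choose (ℓ + 1 - 1 - t) else 0) := by
    rw [← Nat.sum_range_choose, ← Finset.sum_add_distrib]
    apply Finset.sum_le_sum
    intro t ht
    have ht' : t ≤ ℓ := by
      have := Finset.mem_range.mp ht
      omega
    rw [Nat.add_sub_cancel, Nat.choose_symm ht']
    split_ifs <;> omega
  have h4 : 2 ^ 3 ≤ 2 ^ ℓ := Nat.pow_le_pow_right (by norm_num) h
  have h5 : (if ℓ ≤ 2 * ℓ then ℓ.choose ℓ else 0) = 1 := by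
    rw [if_pos (by omega), Nat.choose_self]
  simp only [h5] at h1
  omega
end

section
/- For every real η > 0 there exist a real d > 0 and a natural number N such that for all n ≥ N the following holds: if B is the binomial distribution with ⌈d·log n⌉ trials and success probability 3/8, then the probability under B that the number of successes is less than log₂ n is at most n^(−η). -/
open Classical in
theorem stmt6 (η : ℝ) (hη : 0 < η) :
    ∃ d : ℝ, 0 < d ∧ ∃ N : ℕ, ∀ n : ℕ, N ≤ n →
      ∑ t ∈ (Finset.range (⌈d * Real.log n⌉₊ + 1)).filter
          (fun t : ℕ => (t : ℝ) < Real.logb 2 n),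
        ((⌈d * Real.log n⌉₊).choose t : ℝ) * (3 / 8) ^ t *
          (5 / 8) ^ (⌈d * Real.log n⌉₊ - t)
      ≤ (n : ℝ) ^ (-η) := by
  refine ⟨16 * (1 + η) / 3, by positivity, 1, fun n hn => ?_⟩
  have hn0 : (0 : ℝ) < n := by exact_mod_cast hn
  have hm : 16 * (1 + η) / 3 * Real.log n ≤ (⌈16 * (1 + η) / 3 * Real.log n⌉₊ : ℝ) :=
    Nat.le_ceil _
  generalize ⌈16 * (1 + η) / 3 * Real.log n⌉₊ = m at hm ⊢
  calc _ ≤ ∑ t ∈ (Finset.range (m + 1)).filter (fun t : ℕ => (t : ℝ) < Real.logb 2 n),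
        (n : ℝ) * ((3 / 16) ^ t * (5 / 8) ^ (m - t) * (m.choose t : ℝ)) := by
        refine Finset.sum_le_sum fun t ht => ?_
        have ht2 := (Finset.mem_filter.mp ht).2
        have h2 : (2 : ℝ) ^ t ≤ n := by
          rw [Real.lt_logb_iff_rpow_lt (by norm_num) hn0, Real.rpow_natCast] at ht2
          exact ht2.le
        have h3 : (3 / 8 : ℝ) ^ t = 2 ^ t * (3 / 16) ^ t := by
          rw [← mul_pow]; norm_num
        rw [h3]
        calc _ = (2 : ℝ) ^ t * ((3 / 16) ^ t * (5 / 8) ^ (m - t) * (m.choose t : ℝ)) := by ring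
          _ ≤ _ := mul_le_mul_of_nonneg_right h2 (by positivity)
    _ ≤ ∑ t ∈ Finset.range (m + 1),
        (n : ℝ) * ((3 / 16) ^ t * (5 / 8) ^ (m - t) * (m.choose t : ℝ)) :=
        Finset.sum_le_sum_of_subset_of_nonneg (Finset.filter_subset _ _)
          (fun _ _ _ => by positivity)
    _ = n * (3 / 16 + 5 / 8) ^ m := by rw [← Finset.mul_sum, add_pow]
    _ ≤ n * (Real.exp (-(3 / 16))) ^ m := by
        have := Real.add_one_le_exp (-(3 / 16) : ℝ)
        gcongr
        linarith
    _ = Real.exp (Real.log n + m * (-(3 / 16))) := by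
        rw [Real.exp_add, Real.exp_log hn0, Real.exp_nat_mul]
    _ ≤ Real.exp (Real.log n * -η) := by
        apply Real.exp_le_exp.mpr
        linarith
    _ = _ := (Real.rpow_def_of_pos hn0 _).symm
end

section
/- Let m ≥ 2, let m_0, m_1, …, m_k be a doubling–increment chain for m, and consider the following rewriting rules on unordered pairs of natural-number masses: (10) (m_i, m_i) → (m_{i+1}, 0) whenever m_{i+1} = 2·m_i and i+1 < k; (20) (m_i, 1) → (m_{i+1}, 0) whenever m_{i+1} = m_i + 1 and i+1 < k; (30) (m_{k−1}, m_{k−1}) → (0, 0) whenever m_k = 2·m_{k−1}; (40) (m_{k−1}, 1) → (0, 0) whenever m_k = m_{k−1} + 1; (50) (m_i, m_j) → (m_{i+1}, m_j − 1) whenever m_{i+1} = m_i + 1 and 0 < j ≤ i; (60) (m_{i+1} − 1, 0) → (m_i − 1, m_i) whenever m_{i+1} = 2·m_i and i > 0; (70) (m_{k−1}, m_j) → (0, m_j − 1) whenever m_k = m_{k−1} + 1 and j > 0. Define a step on finite multisets of natural numbers: c ⟶ c' iff c' is obtained from c by removing two elements a, b and inserting a', b' for some rule instance (a, b) → (a',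 b'). Then for every multiset c reachable from an initial multiset c₀ consisting of x copies of 1 and z copies of 0, the sum of the elements of c is at most x and is congruent to x modulo m. -/
/-- The mass-changing rules (10)–(70) of the SlowCongruence protocol, as a relation
`(a, b) → (a', b')` on unordered pairs of masses (indices range over the chain). -/
def SCRule (k : ℕ) (f : ℕ → ℕ) (a b a' b' : ℕ) : Prop :=
  -- (10)
  (∃ i, i + 1 < k ∧ f (i + 1) = 2 * f i ∧
    a = f i ∧ b = f i ∧ a' = f (i + 1) ∧ b' = 0) ∨
  -- (20)
  (∃ i, i + 1 < k ∧ f (i + 1) = f i + 1 ∧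
    a = f i ∧ b = 1 ∧ a' = f (i + 1) ∧ b' = 0) ∨
  -- (30)
  (f k = 2 * f (k - 1) ∧ a = f (k - 1) ∧ b = f (k - 1) ∧ a' = 0 ∧ b' = 0) ∨
  -- (40)
  (f k = f (k - 1) + 1 ∧ a = f (k - 1) ∧ b = 1 ∧ a' = 0 ∧ b' = 0) ∨
  -- (50)
  (∃ i j, i + 1 ≤ k ∧ f (i + 1) = f i + 1 ∧ 0 < j ∧ j ≤ i ∧
    a = f i ∧ b = f j ∧ a' = f (i + 1) ∧ b' = f j - 1) ∨
  -- (60)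
  (∃ i, i + 1 ≤ k ∧ f (i + 1) = 2 * f i ∧ 0 < i ∧
    a = f (i + 1) - 1 ∧ b = 0 ∧ a' = f i - 1 ∧ b' = f i) ∨
  -- (70)
  (∃ j, f k = f (k - 1) + 1 ∧ 0 < j ∧ j ≤ k ∧
    a = f (k - 1) ∧ b = f j ∧ a' = 0 ∧ b' = f j - 1)

/-- One step of the multiset rewriting system: remove two elements `a, b`
and insert `a', b'` for some rule instance `(a, b) → (a', b')`. -/
def SCStep (k : ℕ) (f : ℕ → ℕ) (c c' : Multiset ℕ) : Prop :=
  ∃ (a b a' b' : ℕ) (rest : Multiset ℕ), SCRule k f a b a' b' ∧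
    c = a ::ₘ b ::ₘ rest ∧ c' = a' ::ₘ b' ::ₘ rest

/-- Each rule preserves the mass or lowers it by exactly `m`. -/
theorem SCRule.mass {m k : ℕ} {f : ℕ → ℕ} (hchain : DIChain m k f) {a b a' b' : ℕ}
    (h : SCRule k f a b a' b') : a + b = a' + b' ∨ a + b = a' + b' + m := by
  obtain ⟨-, hk, hpos, -⟩ := hchain
  rcases h with ⟨i, hi, h⟩ | ⟨i, hi, h⟩ | h | h | ⟨i, j, hi, h, hj, hji, h'⟩ |
    ⟨i, hi, h⟩ | ⟨j, h, hj, hjk, h'⟩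
  · omega
  · omega
  · omega
  · omega
  · have := hpos j (by omega)
    omega
  · have := hpos i (by omega)
    omega
  · have := hpos j hjk
    omega

theorem stmt11 (m k : ℕ) (f : ℕ → ℕ) (hm : 2 ≤ m) (hchain : DIChain m k f)
    (x z : ℕ) (c : Multiset ℕ)
    (hreach : Relation.ReflTransGen (SCStep k f)
      (Multiset.replicate x 1 + Multiset.replicate z 0) c) :
    c.sum ≤ x ∧ c.sum ≡ x [MOD m] := by
  induction hreach with
  | refl => simp [Nat.ModEq.refl]
  | tail _ hstep ih =>
    obtain ⟨a, b, a', b', rest, hr, rfl, rfl⟩ := hstep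
    simp only [Multiset.sum_cons] at ih ⊢
    obtain ⟨h1, h2⟩ := ih
    rcases hr.mass hchain with h | h
    · have e : a' + (b' + rest.sum) = a + (b + rest.sum) := by omega
      rw [e]
      exact ⟨h1, h2⟩
    · have e : a + (b + rest.sum) = a' + (b' + rest.sum) + m := by omega
      rw [e] at h1 h2
      refine ⟨by omega, ?_⟩
      simpa [Nat.ModEq] using h2
end

section
/- Fix a natural number N ≥ 1 and consider integer vectors v : Fin N → ℤ. An averaging step replaces two distinct entries a = v(i) and b = v(j) by ⌊(a+b)/2⌋ and ⌈(a+b)/2⌉; a round transformation applies finitely many averaging steps and then doubles every entry. Then: (i) every averaging step preserves the sum of the entries, so if v is obtained from v₀ by r successive round transformations then Σ v = 2^r · Σ v₀; and (ii) if moreover Σ v₀ ≥ 1 and every entry of v lies in the interval [−2, 2], then 2^r ≤ 2N. -/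
/-- An averaging step: two distinct entries `a = v i` and `b = v j` are replaced
by `⌊(a+b)/2⌋` and `⌈(a+b)/2⌉`. -/
def AvgStep (N : ℕ) (v v' : Fin N → ℤ) : Prop :=
  ∃ i j : Fin N, i ≠ j ∧
    v' = Function.update (Function.update v i ((v i + v j).fdiv 2)) j
      ((v i + v j + 1).fdiv 2)

/-- A round transformation: finitely many averaging steps followed by
doubling every entry. -/
def RoundStep (N : ℕ) (v v' : Fin N → ℤ) : Prop :=
  ∃ w, Relation.ReflTransGen (AvgStep N) v w ∧ v' = fun i => 2 * w i

/-- `Rounds N r v₀ v`: `v` is obtained from `v₀` by `r` successive round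
transformations. -/
def Rounds (N : ℕ) : ℕ → (Fin N → ℤ) → (Fin N → ℤ) → Prop
  | 0 => fun v₀ v => v = v₀
  | r + 1 => fun v₀ v => ∃ w, Rounds N r v₀ w ∧ RoundStep N w v

theorem avgStep_sum (N : ℕ) (v v' : Fin N → ℤ) (h : AvgStep N v v') :
    ∑ i, v' i = ∑ i, v i := by
  obtain ⟨i, j, hij, rfl⟩ := h
  have hi : i ∈ Finset.univ \ {j} := by simp [hij]
  rw [Finset.sum_update_of_mem (Finset.mem_univ j), Finset.sum_update_of_mem hi]
  have h1 := Finset.sum_sdiff (f := v) (Finset.subset_univ {j})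
  have h2 := Finset.sum_sdiff (f := v) (Finset.singleton_subset_iff.mpr hi)
  rw [Finset.sum_singleton] at h1 h2
  rw [Int.fdiv_eq_ediv_of_nonneg _ (by norm_num), Int.fdiv_eq_ediv_of_nonneg _ (by norm_num)]
  omega

theorem rounds_sum (N : ℕ) (r : ℕ) (v₀ v : Fin N → ℤ) (h : Rounds N r v₀ v) :
    ∑ i, v i = 2 ^ r * ∑ i, v₀ i := by
  induction r generalizing v with
  | zero =>
    have h' : v = v₀ := h
    simp [h']
  | succ r ih =>
    obtain ⟨w, hw, u, hu, rfl⟩ := h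
    have hs : ∑ i, u i = ∑ i, w i := by
      induction hu with
      | refl => rfl
      | tail _ hb ihb => rw [avgStep_sum N _ _ hb, ihb]
    rw [← Finset.mul_sum, hs, ih w hw]
    ring

theorem stmt12 (N : ℕ) (hN : 1 ≤ N) :
    (∀ v v' : Fin N → ℤ, AvgStep N v v' → ∑ i, v' i = ∑ i, v i) ∧
    (∀ (r : ℕ) (v₀ v : Fin N → ℤ), Rounds N r v₀ v →
      ∑ i, v i = 2 ^ r * ∑ i, v₀ i) ∧
    (∀ (r : ℕ) (v₀ v : Fin N → ℤ), Rounds N r v₀ v → 1 ≤ ∑ i, v₀ i →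
      (∀ i, -2 ≤ v i ∧ v i ≤ 2) → (2 : ℤ) ^ r ≤ 2 * (N : ℤ)) := by
  refine ⟨avgStep_sum N, rounds_sum N, fun r v₀ v h h1 hv => ?_⟩
  have hs := rounds_sum N r v₀ v h
  have hle : ∑ i, v i ≤ ∑ _i : Fin N, (2 : ℤ) := Finset.sum_le_sum fun i _ => (hv i).2
  simp only [Finset.sum_const, Finset.card_univ, Fintype.card_fin, nsmul_eq_mul] at hle
  have hp : (0 : ℤ) < 2 ^ r := by positivity
  nlinarith
end

section
/- Consider the slow parity protocol on n agents with state space {(L,0), (L,1), (F,0), (F,1)} and transitions: (L,x) + (L,y) → (L, (x+y) mod 2) + (F,0), and (L,x) + (F,y) → (L,x) + (F,x), applied to an ordered pair of distinct agents. Then: (i) every transition preserves the number of agents in state (L,1) modulo 2; and (ii) consequently, in any configuration reachable from the initial configuration — in which exactly x agents are in state (L,1) and all remaining agents are in state (F,0) — that contains exactly one agent in a leader state (L,·), the bit of that unique leader is congruent to x modulo 2. -/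
/-- Agent states of the slow parity protocol: a pair of a leader flag
(`true` = leader `L`, `false` = follower `F`) and a parity bit in `ZMod 2`. -/
abbrev SPState := Bool × ZMod 2

/-- One transition of the slow parity protocol, applied to an ordered pair of
distinct agents `i` (initiator) and `j` (responder):
`(L,x) + (L,y) → (L,(x+y) mod 2) + (F,0)` and `(L,x) + (F,y) → (L,x) + (F,x)`. -/
def SPStep (n : ℕ) (v v' : Fin n → SPState) : Prop :=
  ∃ i j : Fin n, i ≠ j ∧
    ((∃ x y : ZMod 2, v i = (true, x) ∧ v j = (true, y) ∧
        v' = Function.update (Function.update v i (true, x + y)) j (false, 0)) ∨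
     (∃ x y : ZMod 2, v i = (true, x) ∧ v j = (false, y) ∧
        v' = Function.update v j (false, x)))

/-- The number of agents in state `(L,1)`. -/
def leaderOneCount (n : ℕ) (v : Fin n → SPState) : ℕ :=
  (Finset.univ.filter fun a => v a = (true, (1 : ZMod 2))).card

/-- The bit contributed by an agent to the leader parity. -/
def spBit (s : SPState) : ZMod 2 := if s.1 = true then s.2 else 0

theorem spBit_eq (s : SPState) :
    (if s = (true, (1 : ZMod 2)) then (1 : ZMod 2) else 0) = spBit s := by
  revert s
  unfold spBit
  decide

theorem leaderOneCount_cast (n : ℕ) (v : Fin n → SPState) :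
    (leaderOneCount n v : ZMod 2) = ∑ a, spBit (v a) := by
  unfold leaderOneCount
  rw [Finset.card_filter]
  push_cast
  exact Finset.sum_congr rfl fun a _ => spBit_eq (v a)

theorem spStep_sum (n : ℕ) (v v' : Fin n → SPState) (h : SPStep n v v') :
    ∑ a, spBit (v' a) = ∑ a, spBit (v a) := by
  obtain ⟨i, j, hij, h⟩ := h
  rw [← sub_eq_zero, ← Finset.sum_sub_distrib]
  rcases h with ⟨x, y, hi, hj, rfl⟩ | ⟨x, y, hi, hj, rfl⟩
  · rw [Fintype.sum_eq_add i j hij]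
    · simp [Function.update_of_ne hij, hi, hj, spBit]
      exact CharTwo.add_self_eq_zero y
    · rintro a ⟨h1, h2⟩
      simp [Function.update_of_ne h1, Function.update_of_ne h2]
  · rw [Fintype.sum_eq_add i j hij]
    · simp [Function.update_of_ne hij, hj, spBit]
    · rintro a ⟨h1, h2⟩
      simp [Function.update_of_ne h2]

theorem stmt13 (n x : ℕ) :
    -- (i) every transition preserves the number of agents in state (L,1) mod 2
    (∀ v v' : Fin n → SPState, SPStep n v v' →
      leaderOneCount n v' ≡ leaderOneCount n v [MOD 2]) ∧
    -- (ii) in any reachable configuration with a unique leader,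
    -- the leader's bit is congruent to x mod 2
    (∀ v₀ v : Fin n → SPState,
      leaderOneCount n v₀ = x →
      (∀ a, v₀ a = (true, (1 : ZMod 2)) ∨ v₀ a = (false, (0 : ZMod 2))) →
      Relation.ReflTransGen (SPStep n) v₀ v →
      ∀ a : Fin n, ((v a).1 = true ∧ ∀ b : Fin n, (v b).1 = true → b = a) →
        (v a).2 = (x : ZMod 2)) := by
  refine ⟨fun v v' h => ?_, fun v₀ v h0 _ hr a ha => ?_⟩
  · rw [← ZMod.natCast_eq_natCast_iff, leaderOneCount_cast, leaderOneCount_cast]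
    exact spStep_sum n v v' h
  · have key : ∑ b, spBit (v b) = ∑ b, spBit (v₀ b) := by
      clear ha
      induction hr with
      | refl => rfl
      | tail _ hs ih => rw [spStep_sum n _ _ hs, ih]
    rw [← h0, leaderOneCount_cast, ← key, Fintype.sum_eq_single a]
    · simp [spBit, ha.1]
    · intro b hb
      have : ¬ (v b).1 = true := fun h => hb (ha.2 b h)
      simp [spBit, this]
end
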